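/- arXiv:math/0001130 — 2 statements merged into one kernel-verified Lean document; each statement's English description precedes it below -/
import Mathlib

section
/- The canonical filtration of a direct sum of Kronecker blocks (Theorem 3.1 of the paper): In the block-diagonal Kronecker model with 0 ≤ n_1 < n_2 < … < n_k, set Φ_0 = ℝ^N and, for i ≥ 1, let Φ_i ⊆ ℝ^N be the span of the union, over all i-tuples (λ^(1),…,λ^(i)) of pairwise non-proportional elements of ℝ² \ {(0,0)}, of the subspaces ⋂_{s=1}^{i} P_{λ^(s)}. Then for every i ≥ 0 one has Φ_i = M_1(i) ⊕ … ⊕ M_k(i), where M_j(i) = V_j if i ≤ n_j and M_j(i) = L_j if i > n_j. Consequently Φ_0 = … = Φ_{n_1} ⊋ Φ_{n_1+1} = … = Φ_{n_2} ⊋ … ⊋ Φ_{n_{k-1}+1} = … = Φ_{n_k} ⊋ Φ_{n_k+1} = Φ_{n_k+2} = …, the filtration stabilizes for i > n_k with Φ_{n_k+1} = L_1 ⊕ … ⊕ L_k, and the numbers n_1,…,n_k are determined by the dimensions of the subspaces Φ_i. -/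
open Matrix

noncomputable section

/-- The `n × (n+1)` matrix `B1(n)`: entries `1` on positions `(i, i)`, else `0`. -/
def kronB1 (K : Type*) [Zero K] [One K] (n : ℕ) : Matrix (Fin n) (Fin (n + 1)) K :=
  Matrix.of fun i j => if (j : ℕ) = (i : ℕ) then 1 else 0

/-- The `n × (n+1)` matrix `B2(n)`: entries `1` on positions `(i, i+1)`, else `0`. -/
def kronB2 (K : Type*) [Zero K] [One K] (n : ℕ) : Matrix (Fin n) (Fin (n + 1)) K :=
  Matrix.of fun i j => if (j : ℕ) = (i : ℕ) + 1 then 1 else 0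

/-- The first member `K1(n)` of the Kronecker block pair of dimension `2n+1`. -/
def kronK1 (K : Type*) [Zero K] [One K] [Neg K] (n : ℕ) :
    Matrix (Fin n ⊕ Fin (n + 1)) (Fin n ⊕ Fin (n + 1)) K :=
  Matrix.fromBlocks 0 (kronB1 K n) (-(kronB1 K n)ᵀ) 0

/-- The second member `K2(n)` of the Kronecker block pair of dimension `2n+1`. -/
def kronK2 (K : Type*) [Zero K] [One K] [Neg K] (n : ℕ) :
    Matrix (Fin n ⊕ Fin (n + 1)) (Fin n ⊕ Fin (n + 1)) K :=
  Matrix.fromBlocks 0 (kronB2 K n) (-(kronB2 K n)ᵀ) 0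

/-- Block-diagonal Kronecker model: the first matrix `C1`, with diagonal blocks
`K1(n_1), …, K1(n_k)`. -/
def blockC1 (k : ℕ) (n : Fin k → ℕ) :
    Matrix (Σ j : Fin k, Fin (n j) ⊕ Fin (n j + 1)) (Σ j : Fin k, Fin (n j) ⊕ Fin (n j + 1)) ℝ :=
  Matrix.blockDiagonal' fun j => kronK1 ℝ (n j)

/-- Block-diagonal Kronecker model: the second matrix `C2`, with diagonal blocks
`K2(n_1), …, K2(n_k)`. -/
def blockC2 (k : ℕ) (n : Fin k → ℕ) :
    Matrix (Σ j : Fin k, Fin (n j) ⊕ Fin (n j + 1)) (Σ j : Fin k, Fin (n j) ⊕ Fin (n j + 1)) ℝ :=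
  Matrix.blockDiagonal' fun j => kronK2 ℝ (n j)

/-- The column space `P_λ` of `C_λ = λ1·C1 + λ2·C2` in the block-diagonal Kronecker model. -/
def blockPcol (k : ℕ) (n : Fin k → ℕ) (l : ℝ × ℝ) :
    Submodule ℝ ((Σ j : Fin k, Fin (n j) ⊕ Fin (n j + 1)) → ℝ) :=
  LinearMap.range (l.1 • blockC1 k n + l.2 • blockC2 k n).mulVecLin

/-- The coordinate subspace `V_j` corresponding to the `j`-th Kronecker block. -/
def blockV (k : ℕ) (n : Fin k → ℕ) (j : Fin k) :
    Submodule ℝ ((Σ j' : Fin k, Fin (n j') ⊕ Fin (n j' + 1)) → ℝ) :=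
  Submodule.span ℝ (Set.range fun y : Fin (n j) ⊕ Fin (n j + 1) =>
    Pi.single (⟨j, y⟩ : Σ j' : Fin k, Fin (n j') ⊕ Fin (n j' + 1)) (1 : ℝ))

/-- The subspace `L_j ⊆ V_j` spanned by the p-coordinates of the `j`-th Kronecker block. -/
def blockL (k : ℕ) (n : Fin k → ℕ) (j : Fin k) :
    Submodule ℝ ((Σ j' : Fin k, Fin (n j') ⊕ Fin (n j' + 1)) → ℝ) :=
  Submodule.span ℝ (Set.range fun i : Fin (n j) =>
    Pi.single (⟨j, Sum.inl i⟩ : Σ j' : Fin k, Fin (n j') ⊕ Fin (n j' + 1)) (1 : ℝ))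

/-- `Φ_i` for the block-diagonal Kronecker model: the span of the union, over all `i`-tuples
of pairwise non-proportional nonzero parameters, of the intersections `⋂ₛ P_{λ^(s)}`. -/
def blockPhi (k : ℕ) (n : Fin k → ℕ) (i : ℕ) :
    Submodule ℝ ((Σ j : Fin k, Fin (n j) ⊕ Fin (n j + 1)) → ℝ) :=
  Submodule.span ℝ
    (⋃ l ∈ {l : Fin i → ℝ × ℝ | (∀ s, l s ≠ 0) ∧
        ∀ s t, s ≠ t → (l s).1 * (l t).2 - (l s).2 * (l t).1 ≠ 0},
      ((⨅ s, blockPcol k n (l s)) :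
        Set ((Σ j : Fin k, Fin (n j) ⊕ Fin (n j + 1)) → ℝ)))

/-- A vector lies in the range of a square matrix iff it is orthogonal to the left kernel. -/
theorem mem_range_mulVecLin_iff {ι K : Type*} [Fintype ι] [DecidableEq ι] [Field K]
    (A : Matrix ι ι K) (x : ι → K) :
    x ∈ LinearMap.range A.mulVecLin ↔ ∀ y : ι → K, y ᵥ* A = 0 → y ⬝ᵥ x = 0 := by
  constructor
  · rintro ⟨z, rfl⟩ y hy
    rw [mulVecLin_apply, dotProduct_mulVec, hy, zero_dotProduct]
  · intro h
    by_contra hx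
    obtain ⟨f, hfx, hf⟩ := Submodule.exists_le_ker_of_notMem hx
    have hdot : ∀ z, f z = (fun i => f (Pi.single i 1)) ⬝ᵥ z := fun z => by
      conv_lhs => rw [pi_eq_sum_univ' z]
      simp [dotProduct, mul_comm]
    refine hfx ((hdot x).trans (h _ ?_))
    refine dotProduct_eq_zero _ fun z => ?_
    rw [← dotProduct_mulVec, ← hdot]
    exact hf ⟨z, rfl⟩

theorem kronB1_mulVec (n : ℕ) (q : Fin (n + 1) → ℝ) (i : Fin n) :
    (kronB1 ℝ n *ᵥ q) i = q i.castSucc := by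
  rw [mulVec, dotProduct, Finset.sum_eq_single i.castSucc]
  · simp [kronB1]
  · intro b _ hb
    have : (b : ℕ) ≠ i := fun h => hb (Fin.ext h)
    simp [kronB1, this]
  · simp

theorem kronB2_mulVec (n : ℕ) (q : Fin (n + 1) → ℝ) (i : Fin n) :
    (kronB2 ℝ n *ᵥ q) i = q i.succ := by
  rw [mulVec, dotProduct, Finset.sum_eq_single i.succ]
  · simp [kronB2]
  · intro b _ hb
    have : (b : ℕ) ≠ i + 1 := fun h => hb (Fin.ext h)
    simp [kronB2, this]
  · simp

theorem kronB1_transpose_mulVec_castSucc (n : ℕ) (p : Fin n → ℝ) (i : Fin n) :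
    ((kronB1 ℝ n)ᵀ *ᵥ p) i.castSucc = p i := by
  simp [mulVec, dotProduct, kronB1, Fin.val_inj]

theorem kronB2_transpose_mulVec_succ (n : ℕ) (p : Fin n → ℝ) (i : Fin n) :
    ((kronB2 ℝ n)ᵀ *ᵥ p) i.succ = p i := by
  simp [mulVec, dotProduct, kronB2, Fin.val_inj]

/-- The transposed Kronecker pencil is injective at every nonzero parameter. -/
theorem eq_zero_of_kronB_transpose_mulVec {n : ℕ} {l : ℝ × ℝ} (hl : l ≠ 0) {p : Fin n → ℝ}
    (h : ∀ m, l.1 * ((kronB1 ℝ n)ᵀ *ᵥ p) m + l.2 * ((kronB2 ℝ n)ᵀ *ᵥ p) m = 0) : p = 0 := by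
  by_cases h1 : l.1 = 0
  · have h2 : l.2 ≠ 0 := fun h2 => hl (Prod.ext h1 h2)
    funext i
    simpa [h1, h2, kronB2_transpose_mulVec_succ] using h i.succ
  · have key : ∀ (a : ℕ) (i : Fin n), (i : ℕ) = a → p i = 0 := by
      intro a
      induction a using Nat.strong_induction_on with
      | _ a ih =>
        intro i hi
        have hz : ((kronB2 ℝ n)ᵀ *ᵥ p) i.castSucc = 0 := by
          rw [mulVec, dotProduct]
          refine Finset.sum_eq_zero fun b _ => ?_
          by_cases hb : (i : ℕ) = b + 1
          · rw [ih b (by omega) b rfl, mul_zero]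
          · simp [kronB2, hb]
        have := h i.castSucc
        rw [hz, kronB1_transpose_mulVec_castSucc] at this
        simpa [h1] using this
    exact funext fun i => key i i rfl

/-- The generator of the kernel of `λ1·B1(n) + λ2·B2(n)`. -/
def kronKer (n : ℕ) (l : ℝ × ℝ) (m : Fin (n + 1)) : ℝ :=
  (-l.1) ^ (m : ℕ) * l.2 ^ (m.rev : ℕ)

theorem kronKer_recurrence (n : ℕ) (l : ℝ × ℝ) (i : Fin n) :
    l.1 * kronKer n l i.castSucc + l.2 * kronKer n l i.succ = 0 := by
  have : n + 1 - ((i : ℕ) + 1) = (n + 1 - (i + 1 + 1)) + 1 := by omega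
  simp only [kronKer, Fin.val_castSucc, Fin.val_succ, Fin.val_rev, this]
  ring

theorem eq_smul_kronKer {n : ℕ} {l : ℝ × ℝ} (hl : l ≠ 0) {q : Fin (n + 1) → ℝ}
    (h : ∀ i : Fin n, l.1 * q i.castSucc + l.2 * q i.succ = 0) :
    ∃ c : ℝ, q = c • kronKer n l := by
  by_cases h2 : l.2 = 0
  · have h1 : l.1 ≠ 0 := fun h1 => hl (Prod.ext h1 h2)
    refine ⟨q (Fin.last n) / (-l.1) ^ n, funext fun m => ?_⟩
    induction m using Fin.lastCases with
    | last => simp [kronKer, h1]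
    | cast i =>
      have hi : q i.castSucc = 0 := by simpa [h1, h2] using h i
      have : n - (i : ℕ) ≠ 0 := by omega
      simp [kronKer, hi, h2, Fin.val_rev, this]
  · refine ⟨q 0 / l.2 ^ n, funext fun m => ?_⟩
    induction m using Fin.induction with
    | zero => simp [kronKer, h2]
    | succ i ih =>
      have hr := kronKer_recurrence n l i
      have hq := h i
      simp only [Pi.smul_apply, smul_eq_mul] at ih ⊢
      refine mul_left_cancel₀ h2 ?_
      linear_combination hq - l.1 * ih - (q 0 / l.2 ^ n) * hr

/-- Vanishing of `∑ m, q m * (-λ1)^m * λ2^(n-m)` at `n + 1` pairwise non-proportional points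
forces `q = 0`. -/
theorem eq_zero_of_kronKer_dotProduct {n : ℕ} {l : Fin (n + 1) → ℝ × ℝ}
    (hl : ∀ s t, s ≠ t → (l s).1 * (l t).2 - (l s).2 * (l t).1 ≠ 0) {q : Fin (n + 1) → ℝ}
    (h : ∀ s, kronKer n (l s) ⬝ᵥ q = 0) : q = 0 := by
  refine eq_zero_of_mulVec_eq_zero
    (M := projVandermonde (fun s => -(l s).1) (fun s => (l s).2)) ?_ (funext h)
  rw [det_projVandermonde]
  refine Finset.prod_ne_zero_iff.2 fun s _ => Finset.prod_ne_zero_iff.2 fun t ht => ?_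
  have := hl s t (Finset.mem_Ioi.1 ht).ne
  contrapose! this
  linear_combination this

/-- The standard pairwise non-proportional parameters `(-a, 1)`. -/
theorem affine_nonproportional {ι : Type*} {a : ι → ℕ} (ha : Function.Injective a) (s t : ι)
    (hst : s ≠ t) :
    ((-(a s : ℝ), (1 : ℝ)) : ℝ × ℝ).1 * ((-(a t : ℝ), (1 : ℝ)) : ℝ × ℝ).2 -
      ((-(a s : ℝ), (1 : ℝ)) : ℝ × ℝ).2 * ((-(a t : ℝ), (1 : ℝ)) : ℝ × ℝ).1 ≠ 0 := by
  have : (a s : ℝ) ≠ a t := fun h => hst (ha (Nat.cast_injective h))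
  contrapose! this
  simp only at this
  linarith

section BlockModel

variable {k : ℕ} {n : Fin k → ℕ}

theorem blockDiagonal'_mulVec_apply {o R : Type*} [Fintype o] [DecidableEq o]
    [NonUnitalNonAssocSemiring R] {m : o → Type*} [∀ j, Fintype (m j)]
    (M : ∀ j, Matrix (m j) (m j) R) (y : (Σ j, m j) → R) (j : o) (a : m j) :
    (blockDiagonal' M *ᵥ y) ⟨j, a⟩ = (M j *ᵥ fun b => y ⟨j, b⟩) a := by
  rw [mulVec, dotProduct, Fintype.sum_sigma, Finset.sum_eq_single j]
  · simp [mulVec, dotProduct]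
  · intro j' _ hj'
    exact Finset.sum_eq_zero fun b _ => by rw [blockDiagonal'_apply_ne _ _ _ hj'.symm, zero_mul]
  · simp

theorem kronK1_transpose (n : ℕ) : (kronK1 ℝ n)ᵀ = -kronK1 ℝ n := by
  simp [kronK1, fromBlocks_transpose, fromBlocks_neg]

theorem kronK2_transpose (n : ℕ) : (kronK2 ℝ n)ᵀ = -kronK2 ℝ n := by
  simp [kronK2, fromBlocks_transpose, fromBlocks_neg]

theorem block_pencil_transpose (l : ℝ × ℝ) :
    (l.1 • blockC1 k n + l.2 • blockC2 k n)ᵀ = -(l.1 • blockC1 k n + l.2 • blockC2 k n) := by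
  have h1 : (blockC1 k n)ᵀ = -blockC1 k n := by
    rw [blockC1, blockDiagonal'_transpose, ← blockDiagonal'_neg]
    exact congrArg _ (funext fun j => kronK1_transpose _)
  have h2 : (blockC2 k n)ᵀ = -blockC2 k n := by
    rw [blockC2, blockDiagonal'_transpose, ← blockDiagonal'_neg]
    exact congrArg _ (funext fun j => kronK2_transpose _)
  rw [transpose_add, transpose_smul, transpose_smul, h1, h2]
  simp [add_comm]

theorem block_pencil_mulVec_inl (l : ℝ × ℝ)
    (y : (Σ j : Fin k, Fin (n j) ⊕ Fin (n j + 1)) → ℝ) (j : Fin k) (i : Fin (n j)) :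
    ((l.1 • blockC1 k n + l.2 • blockC2 k n) *ᵥ y) ⟨j, Sum.inl i⟩ =
      l.1 * y ⟨j, Sum.inr i.castSucc⟩ + l.2 * y ⟨j, Sum.inr i.succ⟩ := by
  rw [add_mulVec, smul_mulVec, smul_mulVec, Pi.add_apply, Pi.smul_apply, Pi.smul_apply,
    blockC1, blockC2, blockDiagonal'_mulVec_apply, blockDiagonal'_mulVec_apply, kronK1, kronK2,
    fromBlocks_mulVec, fromBlocks_mulVec]
  simp [kronB1_mulVec, kronB2_mulVec]

theorem block_pencil_mulVec_inr (l : ℝ × ℝ)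
    (y : (Σ j : Fin k, Fin (n j) ⊕ Fin (n j + 1)) → ℝ) (j : Fin k) (m : Fin (n j + 1)) :
    ((l.1 • blockC1 k n + l.2 • blockC2 k n) *ᵥ y) ⟨j, Sum.inr m⟩ =
      -(l.1 * ((kronB1 ℝ (n j))ᵀ *ᵥ fun i => y ⟨j, Sum.inl i⟩) m +
        l.2 * ((kronB2 ℝ (n j))ᵀ *ᵥ fun i => y ⟨j, Sum.inl i⟩) m) := by
  rw [add_mulVec, smul_mulVec, smul_mulVec, Pi.add_apply, Pi.smul_apply, Pi.smul_apply,
    blockC1, blockC2, blockDiagonal'_mulVec_apply, blockDiagonal'_mulVec_apply, kronK1, kronK2,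
    fromBlocks_mulVec, fromBlocks_mulVec]
  simp [neg_mulVec, Function.comp_def, add_comm]

/-- `P_λ` is cut out by one linear equation on the q-coordinates of each block. -/
theorem mem_blockPcol_iff {l : ℝ × ℝ} (hl : l ≠ 0)
    (x : (Σ j : Fin k, Fin (n j) ⊕ Fin (n j + 1)) → ℝ) :
    x ∈ blockPcol k n l ↔
      ∀ j, kronKer (n j) l ⬝ᵥ (fun m => x ⟨j, Sum.inr m⟩) = 0 := by
  have hker : ∀ y, y ᵥ* (l.1 • blockC1 k n + l.2 • blockC2 k n) = 0 ↔
      (l.1 • blockC1 k n + l.2 • blockC2 k n) *ᵥ y = 0 := fun y => by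
    rw [← mulVec_transpose, block_pencil_transpose, neg_mulVec, neg_eq_zero]
  rw [blockPcol, mem_range_mulVecLin_iff]
  simp only [hker]
  constructor
  · intro h j
    let y : (Σ j : Fin k, Fin (n j) ⊕ Fin (n j + 1)) → ℝ := fun a =>
      if a.1 = j then Sum.elim (fun _ => 0) (kronKer (n a.1) l) a.2 else 0
    have hy := h y <| by
      funext ⟨j', a⟩
      rcases a with i | m
      · rw [block_pencil_mulVec_inl]
        by_cases hj : j' = j
        · simpa [y, hj] using kronKer_recurrence (n j') l i
        · simp [y, hj]
      · rw [block_pencil_mulVec_inr]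
        have : (fun i => y ⟨j', Sum.inl i⟩) = 0 := funext fun i => by simp [y]
        simp [this]
    rw [dotProduct, Fintype.sum_sigma, Finset.sum_eq_single j] at hy
    · simpa [y, dotProduct] using hy
    · intro j' _ hj'
      simp [y, hj']
    · simp
  · intro h y hy
    rw [dotProduct, Fintype.sum_sigma]
    refine Finset.sum_eq_zero fun j _ => ?_
    have hp : (fun i => y ⟨j, Sum.inl i⟩) = 0 :=
      eq_zero_of_kronB_transpose_mulVec hl fun m => by
        have := congrFun hy ⟨j, Sum.inr m⟩
        rw [block_pencil_mulVec_inr] at this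
        exact neg_eq_zero.1 this
    obtain ⟨c, hc⟩ := eq_smul_kronKer (n := n j) hl (q := fun m => y ⟨j, Sum.inr m⟩)
      fun i => by
        have := congrFun hy ⟨j, Sum.inl i⟩
        rwa [block_pencil_mulVec_inl] at this
    have hp' := congrFun hp
    have hc' := congrFun hc
    simp only [Pi.zero_apply] at hp'
    simp only [Pi.smul_apply, smul_eq_mul] at hc'
    have hj := h j
    rw [dotProduct] at hj
    rw [Fintype.sum_sum_type]
    simp only [hp', hc', zero_mul, Finset.sum_const_zero, zero_add, mul_assoc,
      ← Finset.mul_sum, hj, mul_zero]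

theorem mem_blockPhi {i : ℕ} (l : Fin i → ℝ × ℝ) (h0 : ∀ s, l s ≠ 0)
    (hl : ∀ s t, s ≠ t → (l s).1 * (l t).2 - (l s).2 * (l t).1 ≠ 0)
    {x : (Σ j : Fin k, Fin (n j) ⊕ Fin (n j + 1)) → ℝ}
    (hx : ∀ s j, kronKer (n j) (l s) ⬝ᵥ (fun m => x ⟨j, Sum.inr m⟩) = 0) :
    x ∈ blockPhi k n i := by
  refine Submodule.subset_span (Set.mem_biUnion (x := l) ⟨h0, hl⟩ ?_)
  simpa [mem_blockPcol_iff (h0 _)] using hx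

theorem mem_blockPhi_affine {i : ℕ} {a : Fin i → ℕ} (ha : Function.Injective a)
    {x : (Σ j : Fin k, Fin (n j) ⊕ Fin (n j + 1)) → ℝ}
    (hx : ∀ s j, kronKer (n j) (-(a s : ℝ), 1) ⬝ᵥ (fun m => x ⟨j, Sum.inr m⟩) = 0) :
    x ∈ blockPhi k n i :=
  mem_blockPhi (fun s => (-(a s : ℝ), 1)) (by simp) (affine_nonproportional ha) hx

theorem apply_inr_eq_zero_of_mem_blockPhi {i : ℕ} {j : Fin k} (hij : n j < i)
    {x : (Σ j : Fin k, Fin (n j) ⊕ Fin (n j + 1)) → ℝ} (hx : x ∈ blockPhi k n i)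
    (m : Fin (n j + 1)) : x ⟨j, Sum.inr m⟩ = 0 := by
  have hle : blockPhi k n i ≤
      LinearMap.ker (LinearMap.proj (R := ℝ) (φ := fun _ => ℝ)
        (⟨j, Sum.inr m⟩ : Σ j : Fin k, Fin (n j) ⊕ Fin (n j + 1))) := by
    refine Submodule.span_le.2 (Set.iUnion₂_subset fun l hl z hz => ?_)
    obtain ⟨h0, hl⟩ := hl
    have hz' : ∀ s j, kronKer (n j) (l s) ⬝ᵥ (fun m => z ⟨j, Sum.inr m⟩) = 0 := by
      simpa [mem_blockPcol_iff (h0 _)] using hz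
    have := eq_zero_of_kronKer_dotProduct (l := fun s => l (Fin.castLE hij s))
      (fun s t hst => hl _ _ fun h => hst (Fin.castLE_injective hij h)) fun s => hz' _ j
    exact congrFun this m
  exact hle hx

theorem blockL_le_blockPhi (i : ℕ) (j : Fin k) : blockL k n j ≤ blockPhi k n i := by
  refine Submodule.span_le.2 (Set.range_subset_iff.2 fun p => ?_)
  refine mem_blockPhi_affine (a := fun s : Fin i => (s : ℕ)) Fin.val_injective fun s j' => ?_
  refine Finset.sum_eq_zero fun m _ => ?_
  dsimp only
  rw [Pi.single_eq_of_ne (fun h => ?_), mul_zero]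
  obtain ⟨rfl, h⟩ := Sigma.mk.inj h
  cases eq_of_heq h

/-- The q-coordinate vectors of block `j` lie in `Φ_i` for `i ≤ n_j`, by decomposition along the
Lagrange basis at `n_j + 1` points. -/
theorem single_inr_mem_blockPhi {i : ℕ} {j : Fin k} (hij : i ≤ n j) (m : Fin (n j + 1)) :
    Pi.single (⟨j, Sum.inr m⟩ : Σ j' : Fin k, Fin (n j') ⊕ Fin (n j' + 1)) (1 : ℝ) ∈
      blockPhi k n i := by
  let a : Fin (n j + 1) → ℝ × ℝ := fun s => (-((s : ℕ) : ℝ), 1)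
  let V : Matrix (Fin (n j + 1)) (Fin (n j + 1)) ℝ := Matrix.of fun s => kronKer (n j) (a s)
  have hV : IsUnit V := by
    rw [← mulVec_injective_iff_isUnit]
    refine (injective_iff_map_eq_zero V.mulVecLin).2 fun q hq => ?_
    exact eq_zero_of_kronKer_dotProduct
      (affine_nonproportional (a := fun s : Fin (n j + 1) => (s : ℕ)) Fin.val_injective)
      (congrFun hq)
  let e : (Fin (n j + 1) → ℝ) →ₗ[ℝ] ((Σ j' : Fin k, Fin (n j') ⊕ Fin (n j' + 1)) → ℝ) :=
    ∑ m, (LinearMap.single ℝ (fun _ => ℝ) ⟨j, Sum.inr m⟩) ∘ₗ LinearMap.proj m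
  have he : ∀ q m, e q ⟨j, Sum.inr m⟩ = q m := fun q m => by
    simp [e, Finset.sum_apply, Pi.single_apply]
  have he' : ∀ q j' m, j' ≠ j → e q ⟨j', Sum.inr m⟩ = 0 := fun q j' m hj => by
    simp [e, Finset.sum_apply, hj]
  have hsingle : ∀ t, e (V⁻¹ *ᵥ Pi.single t 1) ∈ blockPhi k n i := fun t => by
    refine mem_blockPhi_affine (a := fun s : Fin i => (t.succAbove (Fin.castLE hij s) : ℕ))
      (Fin.val_injective.comp (Fin.succAbove_right_injective.comp (Fin.castLE_injective hij)))
      fun s j' => ?_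
    by_cases hj : j' = j
    · subst hj
      simp only [he]
      have : (V *ᵥ (V⁻¹ *ᵥ Pi.single t 1)) (t.succAbove (Fin.castLE hij s)) = 0 := by
        rw [mulVec_mulVec, mul_nonsing_inv _ ((isUnit_iff_isUnit_det _).1 hV), one_mulVec,
          Pi.single_eq_of_ne (Fin.succAbove_ne _ _)]
      exact this
    · simp [he' _ _ _ hj, dotProduct]
  have hall : ∀ c, e (V⁻¹ *ᵥ c) ∈ blockPhi k n i := fun c => by
    have hc : e (V⁻¹ *ᵥ c) = ∑ t, c t • e (V⁻¹ *ᵥ Pi.single t 1) := by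
      conv_lhs => rw [pi_eq_sum_univ' c]
      simp [mulVec_sum, mulVec_smul]
    rw [hc]
    exact Submodule.sum_mem _ fun t _ => Submodule.smul_mem _ _ (hsingle t)
  have hm := hall (V *ᵥ Pi.single m 1)
  rw [mulVec_mulVec, nonsing_inv_mul _ ((isUnit_iff_isUnit_det _).1 hV), one_mulVec] at hm
  convert hm using 1
  simp only [e, LinearMap.sum_apply, LinearMap.comp_apply, LinearMap.proj_apply]
  rw [Finset.sum_eq_single m]
  · simp
  · intro b _ hb
    simp [hb]
  · simp

theorem blockV_le_blockPhi {i : ℕ} {j : Fin k} (hij : i ≤ n j) :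
    blockV k n j ≤ blockPhi k n i := by
  refine Submodule.span_le.2 (Set.range_subset_iff.2 ?_)
  rintro (p | m)
  · exact blockL_le_blockPhi i j (Submodule.subset_span ⟨p, rfl⟩)
  · exact single_inr_mem_blockPhi hij m

theorem blockPhi_eq_iSup (i : ℕ) :
    blockPhi k n i = ⨆ j : Fin k, if i ≤ n j then blockV k n j else blockL k n j := by
  refine le_antisymm (fun x hx => ?_) (iSup_le fun j => ?_)
  · rw [pi_eq_sum_univ' x]
    refine Submodule.sum_mem _ fun ⟨j, a⟩ _ => ?_
    by_cases hij : i ≤ n j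
    · refine Submodule.smul_mem _ _ (Submodule.mem_iSup_of_mem j ?_)
      rw [if_pos hij]
      exact Submodule.subset_span ⟨a, rfl⟩
    · rcases a with p | m
      · refine Submodule.smul_mem _ _ (Submodule.mem_iSup_of_mem j ?_)
        rw [if_neg hij]
        exact Submodule.subset_span ⟨p, rfl⟩
      · rw [apply_inr_eq_zero_of_mem_blockPhi (not_le.1 hij) hx, zero_smul]
        exact Submodule.zero_mem _
  · split_ifs with hij
    · exact blockV_le_blockPhi hij
    · exact blockL_le_blockPhi i j

theorem blockPhi_antitone : Antitone (blockPhi k n) := by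
  intro i i' hii'
  rw [blockPhi_eq_iSup i']
  refine iSup_le fun j => ?_
  split_ifs with h
  · exact blockV_le_blockPhi (hii'.trans h)
  · exact blockL_le_blockPhi i j

end BlockModel

/-- Theorem 3.1 of the paper: in the block-diagonal Kronecker model with
`n_1 < … < n_k`, one has `Φ_i = M_1(i) ⊕ … ⊕ M_k(i)` with `M_j(i) = V_j` for `i ≤ n_j` and
`M_j(i) = L_j` for `i > n_j`; in particular the inclusions `Φ_{n_j} ⊋ Φ_{n_j+1}` are strict,
and the filtration stabilizes at `L_1 ⊕ … ⊕ L_k` for `i > n_k`. -/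
theorem blockPhi_filtration (k : ℕ) (hk : 1 ≤ k) (n : Fin k → ℕ) (hmono : StrictMono n) :
    (∀ i : ℕ, blockPhi k n i =
      ⨆ j : Fin k, if i ≤ n j then blockV k n j else blockL k n j) ∧
    (∀ j : Fin k, blockPhi k n (n j + 1) < blockPhi k n (n j)) ∧
    (∀ i : ℕ, (∀ j : Fin k, n j < i) → blockPhi k n i = ⨆ j : Fin k, blockL k n j) := by
  refine ⟨blockPhi_eq_iSup, fun j => ?_, fun i hi => ?_⟩
  · refine lt_of_le_of_ne (blockPhi_antitone (Nat.le_succ _)) fun h => ?_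
    have hmem := single_inr_mem_blockPhi (le_refl (n j)) 0
    rw [← h] at hmem
    simpa using apply_inr_eq_zero_of_mem_blockPhi (Nat.lt_succ_self _) hmem 0
  · rw [blockPhi_eq_iSup]
    exact iSup_congr fun j => if_neg (not_le.2 (hi j))

end
end

section
/- A direct sum of Kronecker blocks satisfies the completeness condition: Let k ≥ 1 and let n_1,…,n_k ≥ 0 be arbitrary integers (not necessarily distinct); put N = Σ_{j=1}^k (2n_j+1) and for i = 1,2 let C_i be the complex N×N block-diagonal matrix with diagonal blocks K_i(n_1),…,K_i(n_k). Then for every (λ1,λ2) ∈ ℂ² \ {(0,0)}, the matrix λ1·C1 + λ2·C2 has rank exactly 2·(n_1 + … + n_k); in particular the rank is constant on ℂ² \ {(0,0)}. -/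
open Matrix

noncomputable section

/-- The linear pencil `a • B1(n) + b • B2(n)`. -/
def kronPencil {K : Type*} [Field K] (a b : K) (n : ℕ) : Matrix (Fin n) (Fin (n + 1)) K :=
  a • kronB1 K n + b • kronB2 K n

theorem smul_kronK1_add_smul_kronK2 {K : Type*} [Field K] (a b : K) (n : ℕ) :
    a • kronK1 K n + b • kronK2 K n =
      fromBlocks 0 (kronPencil a b n) (-(kronPencil a b n)ᵀ) 0 := by
  simp [kronK1, kronK2, kronPencil, fromBlocks_smul, fromBlocks_add, add_comm]

/-- Deleting the last or the first column of a nonzero pencil leaves an invertible matrix. -/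
theorem exists_det_kronPencil_submatrix_ne_zero {K : Type*} [Field K] {a b : K}
    (h : a ≠ 0 ∨ b ≠ 0) (n : ℕ) :
    ∃ e : Fin n → Fin (n + 1), ((kronPencil a b n).submatrix id e).det ≠ 0 := by
  by_cases ha : a = 0
  · refine ⟨Fin.succ, ?_⟩
    have hb : b ≠ 0 := h.resolve_left (not_not_intro ha)
    have hS : (kronPencil a b n).submatrix id Fin.succ = diagonal fun _ => b := by
      ext i j
      simp [kronPencil, kronB2, ha, diagonal_apply, Fin.ext_iff, eq_comm]
    rw [hS, det_diagonal]
    simp [hb]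
  · refine ⟨Fin.castSucc, ?_⟩
    rw [det_of_isUpperTriangular]
    · simp [kronPencil, kronB1, kronB2, ha]
    · intro i j hij
      have hlt : (j : ℕ) < i := hij
      simp [kronPencil, kronB1, kronB2, hlt.ne, show (j : ℕ) ≠ i + 1 by omega]

theorem isUnit_fromBlocks_zero_neg_transpose {K : Type*} [Field K] {n : ℕ}
    {S : Matrix (Fin n) (Fin n) K} (hS : S.det ≠ 0) :
    IsUnit (fromBlocks 0 S (-Sᵀ) 0) := by
  have hS' : IsUnit S.det := hS.isUnit
  have hT : IsUnit Sᵀ.det := by rwa [det_transpose]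
  refine IsUnit.of_mul_eq_one (fromBlocks 0 (-Sᵀ⁻¹) S⁻¹ 0) ?_
  simp [fromBlocks_multiply, mul_nonsing_inv _ hS', mul_nonsing_inv _ hT]

theorem rank_blockDiagonal'_kronPencil_le {K ι : Type*} [Field K] [Fintype ι] [DecidableEq ι]
    (a b : K) (n : ι → ℕ) :
    (blockDiagonal' fun j =>
      fromBlocks 0 (kronPencil a b (n j)) (-(kronPencil a b (n j))ᵀ) 0).rank ≤
      2 * ∑ j, n j := by
  have hfac : (fun j => fromBlocks 0 (kronPencil a b (n j)) (-(kronPencil a b (n j))ᵀ) 0) =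
      fun j => fromBlocks (1 : Matrix (Fin (n j)) (Fin (n j)) K) 0 0 (-(kronPencil a b (n j))ᵀ) *
        fromBlocks 0 (kronPencil a b (n j)) (1 : Matrix (Fin (n j)) (Fin (n j)) K) 0 := by
    funext j
    simp [fromBlocks_multiply]
  rw [hfac, blockDiagonal'_mul]
  refine (rank_mul_le_left _ _).trans ((rank_le_card_width _).trans_eq ?_)
  simp [Finset.mul_sum, two_mul]

theorem le_rank_blockDiagonal'_kronPencil {K ι : Type*} [Field K] [Fintype ι] [DecidableEq ι]
    {a b : K} (h : a ≠ 0 ∨ b ≠ 0) (n : ι → ℕ) :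
    2 * ∑ j, n j ≤ (blockDiagonal' fun j =>
      fromBlocks 0 (kronPencil a b (n j)) (-(kronPencil a b (n j))ᵀ) 0).rank := by
  choose e he using fun j => exists_det_kronPencil_submatrix_ne_zero h (n j)
  let S := fun j => (kronPencil a b (n j)).submatrix id (e j)
  let f : (Σ j, Fin (n j) ⊕ Fin (n j)) → Σ j, Fin (n j) ⊕ Fin (n j + 1) :=
    fun p => ⟨p.1, Sum.map id (e p.1) p.2⟩
  have hsub : (blockDiagonal' fun j => fromBlocks 0 (kronPencil a b (n j))
      (-(kronPencil a b (n j))ᵀ) 0).submatrix f f =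
      blockDiagonal' fun j => fromBlocks 0 (S j) (-(S j)ᵀ) 0 := by
    ext ⟨i, x⟩ ⟨j, y⟩
    by_cases hij : i = j
    · subst hij
      rcases x with x | x <;> rcases y with y | y <;>
        simp [f, S, blockDiagonal'_apply_eq]
    · simp [f, blockDiagonal'_apply_ne _ _ _ hij]
  have hunit : IsUnit (blockDiagonal' fun j => fromBlocks 0 (S j) (-(S j)ᵀ) 0) :=
    (Pi.isUnit_iff.mpr fun j => isUnit_fromBlocks_zero_neg_transpose (he j)).map
      (blockDiagonal'RingHom (fun j => Fin (n j) ⊕ Fin (n j)) K)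
  calc 2 * ∑ j, n j = Fintype.card (Σ j, Fin (n j) ⊕ Fin (n j)) := by
        simp [Finset.mul_sum, two_mul]
    _ = (blockDiagonal' fun j => fromBlocks 0 (S j) (-(S j)ᵀ) 0).rank :=
        (rank_of_isUnit _ hunit).symm
    _ ≤ _ := hsub ▸ rank_submatrix_le _ f f

/-- a direct sum of Kronecker blocks satisfies the completeness condition: for
every nonzero `(λ1,λ2) ∈ ℂ²`, the block-diagonal matrix with blocks
`λ1·K1(n_j) + λ2·K2(n_j)`, `j = 1,…,k`, has rank exactly `2(n_1 + ⋯ + n_k)`. -/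
theorem kronecker_sum_complete (k : ℕ) (hk : 1 ≤ k) (n : Fin k → ℕ) (l : ℂ × ℂ) (hl : l ≠ 0) :
    (l.1 • Matrix.blockDiagonal' (fun j : Fin k => kronK1 ℂ (n j)) +
      l.2 • Matrix.blockDiagonal' (fun j : Fin k => kronK2 ℂ (n j))).rank =
      2 * ∑ j : Fin k, n j := by
  have hl' : l.1 ≠ 0 ∨ l.2 ≠ 0 := by
    contrapose! hl
    exact Prod.ext hl.1 hl.2
  have hsum : l.1 • blockDiagonal' (fun j : Fin k => kronK1 ℂ (n j)) +
      l.2 • blockDiagonal' (fun j : Fin k => kronK2 ℂ (n j)) = blockDiagonal' fun j =>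
        fromBlocks 0 (kronPencil l.1 l.2 (n j)) (-(kronPencil l.1 l.2 (n j))ᵀ) 0 := by
    rw [← blockDiagonal'_smul, ← blockDiagonal'_smul, ← blockDiagonal'_add]
    exact congrArg _ (funext fun j => smul_kronK1_add_smul_kronK2 _ _ _)
  rw [hsum]
  exact (rank_blockDiagonal'_kronPencil_le _ _ n).antisymm
    (le_rank_blockDiagonal'_kronPencil hl' n)

end
end
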